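/- arXiv:0802.1853 — 2 statements merged into one kernel-verified Lean document; each statement's English description precedes it below -/
import Mathlib

section
/- For a finite group G the following are equivalent: (1) there is exactly one maximal invariant linked system on G; (2) every self-linked subset A ⊆ G satisfies 2|A| > |G|; (3) |G| ≤ 5, or G is isomorphic to the dihedral group D₆ of order 6, or G is isomorphic to C₂×C₂×C₂. -/
open Pointwise

/-- A family `L` of subsets of `X` is *linked* if any two of its members intersect
(in particular every member is nonempty). -/
def Linked {X : Type*} (L : Set (Set X)) : Prop :=
  ∀ A ∈ L, ∀ B ∈ L, (A ∩ B).Nonempty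

/-- A family `L` of subsets of a group `X` is *invariant* if `xA ∈ L` for all `A ∈ L`
and all `x ∈ X`. -/
def Invariant {X : Type*} [Group X] (L : Set (Set X)) : Prop :=
  ∀ x : X, ∀ A ∈ L, x • A ∈ L

/-- A *maximal invariant linked system* on a group `X` is an invariant linked family of
subsets of `X` not properly contained in any other invariant linked family. -/
def IsMaxInvLinked {X : Type*} [Group X] (L : Set (Set X)) : Prop :=
  Linked L ∧ Invariant L ∧
    ∀ M : Set (Set X), Linked M → Invariant M → L ⊆ M → M = L

/-- A *maximal linked system* on `X` is a linked family of subsets of `X` not properly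
contained in any other linked family. -/
def IsMaxLinked {X : Type*} (L : Set (Set X)) : Prop :=
  Linked L ∧ ∀ M : Set (Set X), Linked M → L ⊆ M → M = L

/-- The operation `A∘B = {C ⊆ X : {x ∈ X : x⁻¹C ∈ B} ∈ A}`, where
`x⁻¹C = {y ∈ X : xy ∈ C}`. -/
def circ {X : Type*} [Group X] (A B : Set (Set X)) : Set (Set X) :=
  {C : Set X | {x : X | (x * ·) ⁻¹' C ∈ B} ∈ A}

theorem inter_nonempty_of_card_lt {α : Type*} [Finite α] {A B : Set α} (h : Nat.card α < A.ncard + B.ncard) :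
    (A ∩ B).Nonempty := by
  by_contra hAB
  rw [Set.not_nonempty_iff_eq_empty, ← Set.disjoint_iff_inter_eq_empty] at hAB
  have h₁ := Set.ncard_union_eq hAB
  have h₂ := Set.ncard_le_card (A ∪ B)
  omega

theorem exists_ncard_eq {α : Type*} {k : ℕ} (h : k ≤ Nat.card α) : ∃ A : Set α, A.ncard = k := by
  rw [← Set.ncard_univ] at h
  obtain ⟨A, -, hA⟩ := Set.exists_subset_card_eq h
  exact ⟨A, hA⟩

/-- A subset `A` of a group is *self-linked* if it meets each of its left translates. -/
def SelfLinked {G : Type*} [Group G] (A : Set G) : Prop :=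
  ∀ x : G, (A ∩ x • A).Nonempty

section

variable {G : Type*} [Group G]

theorem selfLinked_iff {A : Set G} :
    SelfLinked A ↔ ∀ x : G, ∃ a ∈ A, x * a ∈ A := by
  refine forall_congr' fun x => ⟨?_, ?_⟩
  · rintro ⟨_, h, a, ha, rfl⟩
    exact ⟨a, ha, h⟩
  · rintro ⟨a, ha, h⟩
    exact ⟨x * a, h, a, ha, rfl⟩

theorem SelfLinked.smul {A : Set G} (hA : SelfLinked A) (y : G) : SelfLinked (y • A) := by
  rw [selfLinked_iff] at hA ⊢
  intro x
  obtain ⟨a, ha, h⟩ := hA (y⁻¹ * x * y)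
  refine ⟨y * a, ⟨a, ha, rfl⟩, _, h, ?_⟩
  simp [mul_assoc]

theorem SelfLinked.exists_isMaxInvLinked {A : Set G} (hA : SelfLinked A) :
    ∃ L : Set (Set G), IsMaxInvLinked L ∧ A ∈ L := by
  obtain ⟨L, hAL, hL⟩ := zorn_subset_nonempty
    {L : Set (Set G) | Linked L ∧ Invariant L} (by
      intro c hc hchain _
      refine ⟨⋃₀ c, ⟨?_, ?_⟩, fun s hs => Set.subset_sUnion_of_mem hs⟩
      · rintro B ⟨s, hs, hB⟩ C ⟨t, ht, hC⟩
        rcases hchain.total hs ht with h | h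
        · exact (hc ht).1 B (h hB) C hC
        · exact (hc hs).1 B hB C (h hC)
      · rintro x B ⟨s, hs, hB⟩
        exact ⟨s, hs, (hc hs).2 x B hB⟩)
    (Set.range fun x : G => x • A) (by
      refine ⟨?_, ?_⟩
      · rintro _ ⟨x, rfl⟩ _ ⟨y, rfl⟩
        have := hA.smul x (y * x⁻¹)
        simpa [smul_smul] using this
      · rintro x _ ⟨y, rfl⟩
        exact ⟨x * y, by simp [smul_smul]⟩)
  refine ⟨L, ⟨hL.prop.1, hL.prop.2, fun M h₁ h₂ h => ?_⟩, hAL ⟨1, by simp⟩⟩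
  exact (hL.eq_of_subset ⟨h₁, h₂⟩ h).symm

theorem IsMaxInvLinked.selfLinked {L : Set (Set G)} (hL : IsMaxInvLinked L) {A : Set G}
    (hA : A ∈ L) : SelfLinked A :=
  fun x => hL.1 A hA _ (hL.2.1 x A hA)

theorem disjoint_smul_iff {A : Set G} {x : G} :
    Disjoint A (x • A) ↔ ∀ a ∈ A, x * a ∉ A := by
  rw [Set.disjoint_right]
  constructor
  · exact fun h a ha => h ⟨a, ha, rfl⟩
  · rintro h _ ⟨a, ha, rfl⟩
    exact h a ha

theorem ncard_smul (x : G) (A : Set G) : (x • A).ncard = A.ncard :=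
  Set.ncard_image_of_injective A (MulAction.injective x)

theorem card_involutions_congr {G' : Type*} [Group G'] (e : G ≃* G') :
    Nat.card {x : G // x ≠ 1 ∧ x * x = 1} = Nat.card {x : G' // x ≠ 1 ∧ x * x = 1} :=
  Nat.card_congr (e.toEquiv.subtypeEquiv fun x => by simp [← map_mul])

variable [Finite G]

theorem selfLinked_of_card_lt {A : Set G} (h : Nat.card G < 2 * A.ncard) : SelfLinked A := by
  intro x
  apply inter_nonempty_of_card_lt
  rw [ncard_smul]
  omega

theorem SelfLinked.compl {A : Set G} (hA : SelfLinked A) (h : 2 * A.ncard = Nat.card G) :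
    SelfLinked Aᶜ := by
  by_contra hc
  simp only [SelfLinked, not_forall, Set.not_nonempty_iff_eq_empty,
    ← Set.disjoint_iff_inter_eq_empty] at hc
  obtain ⟨x, hx⟩ := hc
  have h₁ : x • Aᶜ ⊆ A := Set.disjoint_compl_left_iff_subset.1 hx
  have h₂ := Set.ncard_add_ncard_compl A
  have h₃ : x • Aᶜ = A := Set.eq_of_subset_of_ncard_le h₁ (by rw [ncard_smul]; omega)
  rw [Set.smul_set_compl] at h₃
  obtain ⟨y, hy, hy'⟩ := hA x
  exact h₃.ge hy hy'

theorem existsUnique_isMaxInvLinked_iff :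
    (∃! L : Set (Set G), IsMaxInvLinked L) ↔
      ∀ A : Set G, SelfLinked A → Nat.card G < 2 * A.ncard := by
  constructor
  · rintro ⟨L, hL, huniq⟩ A hA
    have key : ∀ B : Set G, SelfLinked B → B ∈ L := fun B hB => by
      obtain ⟨M, hM, hBM⟩ := hB.exists_isMaxInvLinked
      exact huniq M hM ▸ hBM
    by_contra! h
    have h₁ : SelfLinked Aᶜ := by
      rcases h.eq_or_lt with h | h
      · exact hA.compl h
      · apply selfLinked_of_card_lt
        have := Set.ncard_add_ncard_compl A
        omega
    obtain ⟨y, hy, hy'⟩ := hL.1 A (key A hA) Aᶜ (key _ h₁)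
    exact hy' hy
  · intro h
    obtain ⟨L, hL, -⟩ := (selfLinked_of_card_lt (A := (Set.univ : Set G)) (by
      rw [Set.ncard_univ]; have := Nat.card_pos (α := G); omega)).exists_isMaxInvLinked
    have key : ∀ M : Set (Set G), IsMaxInvLinked M → M = {A | SelfLinked A} := fun M hM => by
      refine (hM.2.2 _ ?_ ?_ fun A hA => hM.selfLinked hA).symm
      · intro A hA B hB
        have h₁ := h A hA
        have h₂ := h B hB
        exact inter_nonempty_of_card_lt (by omega)
      · exact fun x A hA => SelfLinked.smul hA x
    exact ⟨L, hL, fun M hM => (key M hM).trans (key L hL).symm⟩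

/-- In a cyclic group of order at least six, the powers of a generator with exponents in
`{0, …, k - 2} ∪ {k}`, where `k = |G| / 2`, form a self-linked set. -/
theorem exists_selfLinked_of_isCyclic [IsCyclic G] (hG : 6 ≤ Nat.card G) :
    ∃ A : Set G, SelfLinked A ∧ 2 * A.ncard ≤ Nat.card G := by
  obtain ⟨g, hg⟩ := IsCyclic.exists_generator (α := G)
  have hord := orderOf_eq_card_of_forall_mem_zpowers hg
  set n := Nat.card G with hn
  obtain ⟨k, hk⟩ : ∃ k, k = n / 2 := ⟨_, rfl⟩
  let I : Finset ℕ := insert k (Finset.range (k - 1))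
  refine ⟨(fun i => g ^ i) '' (I : Set ℕ), ?_, ?_⟩
  · have small : ∀ j ≤ k, ∃ a ∈ I, a + j ∈ I := by
      intro j hj
      simp only [I, Finset.mem_insert, Finset.mem_range]
      by_cases h : j = 1
      · exact ⟨0, by omega⟩
      · by_cases h : j = 0
        · exact ⟨0, by omega⟩
        · exact ⟨k - j, by omega⟩
    rw [selfLinked_iff]
    intro x
    have hx : x ∈ Submonoid.powers g := mem_powers_iff_mem_zpowers.2 (hg x)
    obtain ⟨j, hj, rfl⟩ : ∃ j < n, g ^ j = x := by
      obtain ⟨j, rfl⟩ := hx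
      exact ⟨j % n, Nat.mod_lt _ (by omega), by rw [← hord]; exact pow_mod_orderOf g j⟩
    rcases le_or_gt j k with h | h
    · obtain ⟨a, ha, haj⟩ := small j h
      exact ⟨_, ⟨a, ha, rfl⟩, a + j, haj, by simp only [← pow_add, add_comm]⟩
    · obtain ⟨a, ha, haj⟩ := small (n - j) (by omega)
      refine ⟨_, ⟨a + (n - j), haj, rfl⟩, a, ha, ?_⟩
      simp only [← pow_add]
      rw [show j + (a + (n - j)) = a + n by omega, pow_add, ← hord, pow_orderOf_eq_one, mul_one]
  · have h₁ := Set.ncard_image_le (f := fun i => g ^ i) I.finite_toSet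
    have h₂ : I.card ≤ k - 1 + 1 :=
      (Finset.card_insert_le _ _).trans (by rw [Finset.card_range])
    rw [Set.ncard_coe_finset] at h₁
    omega

/-- In a noncyclic group of odd order `2 k + 1`, every `k`-element subset is self-linked. -/
theorem selfLinked_of_odd (hG : ¬ IsCyclic G) {A : Set G}
    (hA : 2 * A.ncard + 1 = Nat.card G) : SelfLinked A := by
  by_contra hc
  simp only [SelfLinked, not_forall, Set.not_nonempty_iff_eq_empty,
    ← Set.disjoint_iff_inter_eq_empty] at hc
  obtain ⟨x, hx⟩ := hc
  have hcard := Set.ncard_union_eq hx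
  have hcompl := Set.ncard_add_ncard_compl (A ∪ x • A)
  rw [ncard_smul] at hcard
  obtain ⟨c, hcA⟩ := Set.ncard_eq_one.1 (show (A ∪ x • A)ᶜ.ncard = 1 by omega)
  rw [disjoint_smul_iff] at hx
  have hstep : ∀ h, x * h ≠ c → (x * h ∈ A ↔ h ∉ A) := by
    intro h hhc
    refine ⟨fun h₁ h₂ => hx h h₂ h₁, fun h₁ => ?_⟩
    have : x * h ∉ (A ∪ x • A)ᶜ := by rw [hcA]; exact hhc
    rw [Set.mem_compl_iff, not_not] at this
    rcases this with h₂ | ⟨a, ha, hah⟩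
    · exact h₂
    · exact absurd (mul_left_cancel hah ▸ ha) h₁
  refine hG ⟨x, fun y => ?_⟩
  by_contra hy
  have hne : ∀ j : ℕ, x ^ j * (y * c) ≠ c := by
    intro j hj
    rw [← mul_assoc, mul_eq_right, ← eq_inv_iff_mul_eq_one] at hj
    apply hy
    rw [← inv_inv y, ← hj]
    exact inv_mem (Subgroup.npow_mem_zpowers x j)
  have halt : ∀ j : ℕ, x ^ j * (y * c) ∈ A ↔ (y * c ∈ A ↔ Even j) := by
    intro j
    induction j with
    | zero => simp
    | succ j ih =>
      have h₁ := hne (j + 1)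
      rw [pow_succ', mul_assoc] at h₁ ⊢
      rw [hstep _ h₁, ih, Nat.even_add_one]
      tauto
  have hodd : ¬ Even (orderOf x) := fun h => by
    have := even_iff_two_dvd.1 h |>.trans (orderOf_dvd_natCard x)
    omega
  have := halt (orderOf x)
  simp [pow_orderOf_eq_one, hodd] at this

theorem selfLinked_of_half {A : Set G} (hA : 2 * A.ncard = Nat.card G)
    (h : ∀ x : G, ¬ ∀ g, x * g ∈ A ↔ g ∉ A) : SelfLinked A := by
  by_contra hc
  simp only [SelfLinked, not_forall, Set.not_nonempty_iff_eq_empty,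
    ← Set.disjoint_iff_inter_eq_empty] at hc
  obtain ⟨x, hx⟩ := hc
  have h₂ := Set.ncard_add_ncard_compl A
  have h₃ : x • A = Aᶜ := Set.eq_of_subset_of_ncard_le
    (Set.subset_compl_iff_disjoint_left.2 hx) (by rw [ncard_smul]; omega)
  refine h x fun g => ?_
  rw [← not_iff_not, ← Set.mem_compl_iff, ← h₃, not_not]
  exact Set.smul_mem_smul_set_iff

theorem card_subtype_flip_le {x : G} (hx : x ≠ 1) :
    Nat.card {A : Finset G // ∀ g, x * g ∈ A ↔ g ∉ A} ≤ 2 ^ (Nat.card G / 2) := by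
  let H := Subgroup.zpowers x
  let Q := Quotient (QuotientGroup.rightRel H)
  have hQ : Nat.card Q = H.index :=
    Nat.card_congr (QuotientGroup.quotientRightRelEquivQuotientLeftRel H)
  have : Finite Q := Quotient.finite _
  have hQ' : Nat.card Q ≤ Nat.card G / 2 := by
    have h₁ := H.card_mul_index
    have h₂ : 2 ≤ Nat.card H := by
      have h₃ : 0 < Nat.card H := Nat.card_pos
      have h₄ : Nat.card H ≠ 1 := by
        rw [Ne, Subgroup.card_eq_one, Subgroup.zpowers_eq_bot]
        exact hx
      omega
    rw [hQ, Nat.le_div_iff_mul_le two_pos, ← h₁, mul_comm]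
    exact Nat.mul_le_mul_right _ h₂
  have hset : Nat.card (Set Q) = 2 ^ Nat.card Q := by
    simp [Set, Nat.card_fun]
  refine le_trans ?_ (hset.le.trans (Nat.pow_le_pow_right two_pos hQ'))
  refine Nat.card_le_card_of_injective
    (fun A : {A : Finset G // ∀ g, x * g ∈ A ↔ g ∉ A} => {q : Q | q.out ∈ A.1}) ?_
  rintro ⟨A, hA⟩ ⟨B, hB⟩ hAB
  have hiff : ∀ q : Q, q.out ∈ A ↔ q.out ∈ B := fun q => Set.ext_iff.1 hAB q
  ext g
  have hrel : QuotientGroup.rightRel H (⟦g⟧ : Q).out g := Quotient.mk_out g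
  rw [QuotientGroup.rightRel_apply] at hrel
  obtain ⟨j, hj⟩ := mem_powers_iff_mem_zpowers.2 hrel
  have hpow : ∀ (j : ℕ) (h : G), (h ∈ A ↔ h ∈ B) → (x ^ j * h ∈ A ↔ x ^ j * h ∈ B) := by
    intro j h hh
    induction j with
    | zero => simpa using hh
    | succ j ih => rw [pow_succ', mul_assoc, hA, hB, ih]
  have := hpow j _ (hiff ⟦g⟧)
  simpa [hj] using this

theorem mul_two_pow_lt_centralBinom {k : ℕ} (hk : 6 ≤ k) :
    (2 * k) * 2 ^ k < Nat.centralBinom k + 2 ^ k := by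
  induction k, hk using Nat.le_induction with
  | base => decide
  | succ k hk ih =>
    have h := Nat.succ_mul_centralBinom_succ k
    rw [pow_succ]
    obtain ⟨p, hp⟩ : ∃ p, p = 2 ^ k := ⟨_, rfl⟩
    have hp0 : 0 < p := hp ▸ by positivity
    rw [← hp] at ih ⊢
    by_contra! hcon
    nlinarith

theorem exists_selfLinked_of_even {k : ℕ} (hG : Nat.card G = 2 * k) (hk : 6 ≤ k) :
    ∃ A : Set G, SelfLinked A ∧ 2 * A.ncard ≤ Nat.card G := by
  classical
  have := Fintype.ofFinite G
  let flip (x : G) : Finset (Finset G) := {A | ∀ g, x * g ∈ A ↔ g ∉ A}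
  have hflip : ∀ x ∈ Finset.univ.erase (1 : G), (flip x).card ≤ 2 ^ k := by
    intro x hx
    have := card_subtype_flip_le (Finset.ne_of_mem_erase hx)
    rwa [Nat.card_eq_fintype_card, Fintype.card_subtype, hG, Nat.mul_div_cancel_left _ two_pos]
      at this
  have hbad := Finset.card_biUnion_le_card_mul _ flip _ hflip
  have hlt : ((Finset.univ.erase (1 : G)).biUnion flip).card <
      (Finset.powersetCard k (Finset.univ : Finset G)).card := by
    refine hbad.trans_lt ?_
    rw [Finset.card_powersetCard, Finset.card_erase_of_mem (Finset.mem_univ _),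
      Finset.card_univ, ← Nat.card_eq_fintype_card, hG, Nat.sub_mul, one_mul,
      ← Nat.centralBinom_eq_two_mul_choose]
    have := mul_two_pow_lt_centralBinom hk
    have : 2 ^ k ≤ 2 * k * 2 ^ k := Nat.le_mul_of_pos_left _ (by omega)
    omega
  obtain ⟨A, hA, hA'⟩ := Finset.exists_mem_notMem_of_card_lt_card hlt
  have hcard : (A : Set G).ncard = k := by
    rw [Set.ncard_coe_finset, (Finset.mem_powersetCard.1 hA).2]
  refine ⟨A, selfLinked_of_half (by omega) fun x hx => ?_, by omega⟩
  have hx1 : x ≠ 1 := by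
    rintro rfl
    simpa using hx 1
  exact hA' (Finset.mem_biUnion.2 ⟨x, by simpa using hx1, by simpa [flip] using hx⟩)

theorem exists_selfLinked_of_index_two {H : Subgroup G} (hH : H.index = 2)
    (hcard : 3 ≤ Nat.card H) {y : G} (hy : y ∉ H) (hyy : y * y ≠ 1) :
    ∃ A : Set G, SelfLinked A ∧ 2 * A.ncard ≤ Nat.card G := by
  refine ⟨insert y ((H : Set G) \ {1}), selfLinked_iff.2 fun x => ?_, ?_⟩
  · by_cases hx : x ∈ H
    · obtain ⟨a, ha, ha'⟩ : ∃ a ∈ (H : Set G), a ∉ ({1, x⁻¹} : Set G) := by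
        refine Set.exists_mem_notMem_of_ncard_lt_ncard ?_
        exact lt_of_le_of_lt (Set.ncard_insert_le _ _) (by
          rw [Set.ncard_singleton]
          exact hcard)
      simp only [Set.mem_insert_iff, Set.mem_singleton_iff, not_or] at ha'
      refine ⟨a, Or.inr ⟨ha, ha'.1⟩, Or.inr ⟨mul_mem hx ha, fun h => ha'.2 ?_⟩⟩
      exact eq_inv_of_mul_eq_one_right h
    · by_cases hxy : x * y = 1
      · refine ⟨y * y, Or.inr ⟨Subgroup.mul_self_mem_of_index_two hH y, hyy⟩, Or.inl ?_⟩
        rw [← mul_assoc, hxy, one_mul]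
      · refine ⟨y, Or.inl rfl, Or.inr ⟨?_, hxy⟩⟩
        exact (Subgroup.mul_mem_iff_of_index_two hH).2 (iff_of_false hx hy)
  · have h₁ := Set.ncard_insert_le y ((H : Set G) \ {1})
    have h₂ := Set.ncard_sdiff_singleton_add_one (s := (H : Set G)) H.one_mem
    have h₃ : (H : Set G).ncard = Nat.card H := Nat.card_coe_set_eq _
    have h₄ := H.card_mul_index
    rw [hH] at h₄
    omega

theorem exists_selfLinked_of_index_two_of_five_le {H : Subgroup G} (hH : H.index = 2)
    (hcard : 5 ≤ Nat.card H) : ∃ A : Set G, SelfLinked A ∧ 2 * A.ncard ≤ Nat.card G := by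
  have hHn : (H : Set G).ncard = Nat.card H := Nat.card_coe_set_eq _
  have hG := H.card_mul_index
  rw [hH] at hG
  have hHc := Set.ncard_add_ncard_compl (H : Set G)
  obtain ⟨t, ht, ht'⟩ : ∃ t ∈ (H : Set G), t ∉ ({1} : Set G) := by
    refine Set.exists_mem_notMem_of_ncard_lt_ncard ?_
    rw [Set.ncard_singleton]
    omega
  obtain ⟨u, hu, hu'⟩ : ∃ u ∈ (H : Set G), u ∉ ({1, t, t⁻¹} : Set G) := by
    refine Set.exists_mem_notMem_of_ncard_lt_ncard ?_
    have := Set.ncard_insert_le 1 ({t, t⁻¹} : Set G)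
    have := Set.ncard_insert_le t ({t⁻¹} : Set G)
    rw [Set.ncard_singleton] at this
    omega
  obtain ⟨s, hs⟩ : ((H : Set G)ᶜ).Nonempty := by
    rw [← Set.ncard_pos]
    omega
  simp only [Set.mem_insert_iff, Set.mem_singleton_iff, not_or] at ht' hu'
  have hs : s ∉ H := hs
  have hsu : s * u ∉ H := fun h => hs ((H.mul_mem_cancel_right hu).1 h)
  refine ⟨{1, t} ∪ ((H : Set G)ᶜ \ {s, s * u}), selfLinked_iff.2 fun x => ?_, ?_⟩
  · by_cases hx : x ∈ H
    · obtain ⟨a, ha, ha'⟩ : ∃ a ∈ (H : Set G)ᶜ,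
          a ∉ ({s, s * u, x⁻¹ * s, x⁻¹ * (s * u)} : Set G) := by
        refine Set.exists_mem_notMem_of_ncard_lt_ncard ?_
        have := Set.ncard_insert_le s ({s * u, x⁻¹ * s, x⁻¹ * (s * u)} : Set G)
        have := Set.ncard_insert_le (s * u) ({x⁻¹ * s, x⁻¹ * (s * u)} : Set G)
        have := Set.ncard_insert_le (x⁻¹ * s) ({x⁻¹ * (s * u)} : Set G)
        rw [Set.ncard_singleton] at this
        omega
      simp only [Set.mem_insert_iff, Set.mem_singleton_iff, not_or, eq_inv_mul_iff_mul_eq] at ha'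
      refine ⟨a, Or.inr ⟨ha, by simp [ha']⟩, Or.inr ⟨?_, by simp [ha']⟩⟩
      exact fun h => ha ((H.mul_mem_cancel_left hx).1 h)
    · by_cases hxs : x = s
      · refine ⟨t, Or.inl (by simp), Or.inr ⟨?_, ?_⟩⟩
        · exact fun h => hx ((H.mul_mem_cancel_right ht).1 h)
        · simp [hxs, ht', Ne.symm hu'.2.1]
      · by_cases hxsu : x = s * u
        · refine ⟨t, Or.inl (by simp), Or.inr ⟨?_, ?_⟩⟩
          · exact fun h => hx ((H.mul_mem_cancel_right ht).1 h)
          · have : u * t ≠ 1 := fun h => hu'.2.2 (eq_inv_of_mul_eq_one_left h)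
            simp [hxsu, ht', mul_assoc, this]
        · exact ⟨1, Or.inl (by simp), Or.inr ⟨by simpa using hx, by simp [hxs, hxsu]⟩⟩
  · have h₁ := Set.ncard_union_le {1, t} ((H : Set G)ᶜ \ {s, s * u})
    have h₂ := Set.ncard_insert_le 1 ({t} : Set G)
    have h₃ : ({s, s * u} : Set G).ncard = 2 := Set.ncard_pair (by simpa using hu'.1)
    have h₄ := Set.ncard_sdiff (t := (H : Set G)ᶜ) (s := {s, s * u}) (by
      rintro z (rfl | rfl)
      exacts [hs, hsu])
    rw [Set.ncard_singleton] at h₂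
    omega

theorem exists_subgroup_index_two_of_prime {p : ℕ} (hp : p.Prime) (hG : Nat.card G = p * 2) :
    ∃ r : G, orderOf r = p ∧ (Subgroup.zpowers r).index = 2 := by
  have := Fact.mk hp
  obtain ⟨r, hr⟩ := exists_prime_orderOf_dvd_card' (G := G) p (hG ▸ dvd_mul_right p 2)
  refine ⟨r, hr, ?_⟩
  have h := (Subgroup.zpowers r).card_mul_index
  rw [Nat.card_zpowers, hr, hG] at h
  exact Nat.eq_of_mul_eq_mul_left hp.pos h

theorem nonempty_mulEquiv_dihedralGroup_three {r : G} (hG : Nat.card G = 6) (hr : orderOf r = 3)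
    (hinv : ∀ y ∉ Subgroup.zpowers r, y * y = 1) : Nonempty (G ≃* DihedralGroup 3) := by
  obtain ⟨s, hs⟩ : ∃ s, s ∉ Subgroup.zpowers r := by
    by_contra! h
    have := orderOf_eq_card_of_forall_mem_zpowers h
    omega
  let P : ZMod 3 → G := fun i => r ^ i.val
  have hPmem : ∀ i, P i ∈ Subgroup.zpowers r := fun i => Subgroup.npow_mem_zpowers r _
  have hadd : ∀ i j, P (i + j) = P i * P j := by
    intro i j
    simp only [P, ZMod.val_add, ← pow_add]
    conv_rhs => rw [← pow_mod_orderOf, hr]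
  have hsub : ∀ i j, P (j - i) = (P i)⁻¹ * P j := by
    intro i j
    rw [eq_inv_mul_iff_mul_eq, ← hadd, add_sub_cancel]
  have hP0 : P 0 = 1 := by simp [P]
  have hPinj : Function.Injective P := by
    intro i j hij
    apply ZMod.val_injective
    exact pow_injOn_Iio_orderOf (by simpa [hr] using i.val_lt) (by simpa [hr] using j.val_lt) hij
  have hss : s * s = 1 := hinv s hs
  have hsP : ∀ i, s * P i ∉ Subgroup.zpowers r := fun i h =>
    hs ((Subgroup.mul_mem_cancel_right _ (hPmem i)).1 h)
  have hcomm : ∀ i, P i * s = s * (P i)⁻¹ := by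
    intro i
    have := hinv _ (hsP i)
    rw [eq_mul_inv_iff_mul_eq, ← mul_right_inj s, hss, ← mul_assoc, ← mul_assoc, mul_assoc, this]
  let f : DihedralGroup 3 → G
    | .r i => P i
    | .sr i => s * P i
  have hf : ∀ x y, f (x * y) = f x * f y := by
    rintro (i | i) (j | j)
    · simp [f, hadd]
    · simp [f, hsub, ← mul_assoc, hcomm]
    · simp [f, hadd, mul_assoc]
    · have : s * P i * (s * P j) = s * (P i * s) * P j := by simp only [mul_assoc]
      simp only [f, DihedralGroup.sr_mul_sr, hsub, this, hcomm]
      rw [← mul_assoc s, hss, one_mul]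
  have hinj : Function.Injective f := by
    rintro (i | i) (j | j) hij
    · exact congrArg _ (hPinj hij)
    · have hij : P i = s * P j := hij
      exact absurd (hij ▸ hPmem i) (hsP j)
    · have hij : s * P i = P j := hij
      exact absurd (hij ▸ hPmem j) (hsP i)
    · exact congrArg _ (hPinj (mul_left_cancel hij))
  have hbij : Function.Bijective f :=
    hinj.bijective_of_nat_card_le (by rw [hG, DihedralGroup.nat_card])
  exact ⟨(MulEquiv.ofBijective (MulHom.mk f hf) hbij).symm⟩

theorem nonempty_mulEquiv_of_card_eq_eight (hG : Nat.card G = 8) (hinv : ∀ x : G, x * x = 1) :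
    Nonempty (G ≃* Multiplicative (ZMod 2 × ZMod 2 × ZMod 2)) := by
  have hcomm : ∀ x y : G, x * y = y * x := by
    have h : ∀ x : G, x⁻¹ = x := fun x => inv_eq_of_mul_eq_one_left (hinv x)
    intro x y
    rw [← h (x * y), mul_inv_rev, h, h]
  let _ : CommGroup G := { ‹Group G› with mul_comm := hcomm }
  let _ : Module (ZMod 2) (Additive G) := AddCommGroup.zmodModule fun x => by
    rw [two_nsmul]
    exact hinv x.toMul
  have hrank : Module.finrank (ZMod 2) (Additive G) = 3 := by
    have h := Module.natCard_eq_pow_finrank (K := ZMod 2) (V := Additive G)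
    rw [Nat.card_zmod, show Nat.card (Additive G) = 2 ^ 3 from hG] at h
    exact (Nat.pow_right_injective le_rfl h).symm
  have e : Additive G ≃ₗ[ZMod 2] ZMod 2 × ZMod 2 × ZMod 2 :=
    LinearEquiv.ofFinrankEq _ _ (by simp [hrank])
  exact ⟨AddEquiv.toMultiplicativeRight e.toAddEquiv⟩

theorem exists_selfLinked_of_card_eq_eight (hG : Nat.card G = 8) (hcyc : ¬ IsCyclic G)
    {r : G} (hr : r * r ≠ 1) : ∃ A : Set G, SelfLinked A ∧ 2 * A.ncard ≤ Nat.card G := by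
  have hord : orderOf r = 4 := by
    have h₁ : orderOf r ∣ 8 := hG ▸ orderOf_dvd_natCard r
    have h₂ : orderOf r ≠ 8 := fun h => hcyc (isCyclic_of_orderOf_eq_card r (h.trans hG.symm))
    have h₃ : ¬ orderOf r ∣ 2 := by rwa [orderOf_dvd_iff_pow_eq_one, pow_two]
    have h₄ : orderOf r ≤ 8 := Nat.le_of_dvd (by norm_num) h₁
    interval_cases orderOf r <;> simp_all
  have hindex : (Subgroup.zpowers r).index = 2 := by
    have h := (Subgroup.zpowers r).card_mul_index
    rw [Nat.card_zpowers, hord, hG] at h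
    omega
  by_cases hall : ∀ y ∉ Subgroup.zpowers r, y * y = 1
  · obtain ⟨s, hs⟩ : ∃ s, s ∉ Subgroup.zpowers r := by
      by_contra! h
      exact hcyc ⟨r, h⟩
    have hss := hall s hs
    have hsr : s * r * (s * r) = 1 := hall _ fun h =>
      hs ((Subgroup.mul_mem_cancel_right _ (Subgroup.mem_zpowers r)).1 h)
    have hrs : r * s = s * r⁻¹ := by
      rw [eq_mul_inv_iff_mul_eq, ← mul_right_inj s, hss, ← hsr]
      simp only [mul_assoc]
    have hr4 : r * r * (r * r) = 1 := by
      rw [← pow_two, ← pow_two, ← pow_mul, show 2 * 2 = orderOf r from hord.symm,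
        pow_orderOf_eq_one]
    -- The centralizer of `s` is a Klein four-group that does not contain `r`.
    let H := Subgroup.centralizer ({s} : Set G)
    have hrH : r ∉ H := by
      rw [Subgroup.mem_centralizer_singleton_iff]
      intro h
      rw [hrs, mul_right_inj] at h
      exact hr (by nth_rewrite 1 [← h]; exact inv_mul_cancel r)
    have hsH : s ∈ H := by rw [Subgroup.mem_centralizer_singleton_iff]
    have hrrH : r * r ∈ H := by
      rw [Subgroup.mem_centralizer_singleton_iff, mul_assoc, hrs, ← mul_assoc, hrs, mul_assoc,
        mul_right_inj, ← mul_inv_rev]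
      exact inv_eq_of_mul_eq_one_left hr4
    have h₁ := H.card_mul_index
    have h₂ : 3 ≤ Nat.card H := by
      have hsub : ({1, s, r * r} : Set G) ⊆ H := by
        rintro z (rfl | rfl | rfl)
        exacts [H.one_mem, hsH, hrrH]
      have hle := Set.ncard_le_ncard hsub
      rwa [Set.ncard_eq_three.2 ⟨1, s, r * r, ?_, hr.symm, ?_, rfl⟩,
        ← Nat.card_coe_set_eq] at hle
      · rintro rfl
        exact hs (one_mem _)
      · intro h
        exact hs (h ▸ mul_mem (Subgroup.mem_zpowers r) (Subgroup.mem_zpowers r))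
    have h₃ : H.index ≠ 1 := by
      rw [Ne, Subgroup.index_eq_one]
      intro h
      exact hrH (h ▸ Subgroup.mem_top r)
    have h₄ : H.index = 2 := by
      have h₅ : H.index ∣ 8 := hG ▸ H.index_dvd_card
      have h₆ : H.index < 3 := by
        by_contra! h
        have := Nat.mul_le_mul h₂ h
        omega
      have h₇ : H.index ≠ 0 := H.index_ne_zero_of_finite
      omega
    exact exists_selfLinked_of_index_two h₄ h₂ hrH hr
  · push Not at hall
    obtain ⟨y, hy, hyy⟩ := hall
    exact exists_selfLinked_of_index_two hindex (by rw [Nat.card_zpowers, hord]; norm_num) hy hyy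

/-- The quotients `a * b⁻¹` of distinct elements of a self-linked set cover each nontrivial
element at least once, and each involution at least twice. -/
theorem SelfLinked.card_add_card_involutions_le {A : Set G} (hA : SelfLinked A) :
    Nat.card G + Nat.card {x : G // x ≠ 1 ∧ x * x = 1} + A.ncard ≤ A.ncard * A.ncard + 1 := by
  classical
  have := Fintype.ofFinite G
  rw [selfLinked_iff] at hA
  choose a ha hxa using hA
  let f : G ⊕ G → G × G := Sum.elim (fun x => (x * a x, a x)) fun x => (a x, x * a x)
  let I : Finset G := {x | x ≠ 1 ∧ x * x = 1}
  have hmaps : Set.MapsTo f ((Finset.univ.erase (1 : G)).disjSum I : Finset (G ⊕ G))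
      (A.toFinset.offDiag : Finset (G × G)) := by
    rintro (x | x) hx
    · simp only [Finset.mem_coe, Finset.inl_mem_disjSum, Finset.mem_erase] at hx
      simp [f, ha, hxa, hx.1]
    · simp only [Finset.mem_coe, Finset.inr_mem_disjSum, I, Finset.mem_filter] at hx
      simp [f, ha, hxa, hx.2.1]
  have hinj : Set.InjOn f ((Finset.univ.erase (1 : G)).disjSum I : Finset (G ⊕ G)) := by
    have mixed : ∀ x y : G, x ≠ 1 → y * y = 1 → (x * a x, a x) ≠ (a y, y * a y) := by
      intro x y hx hy h
      obtain ⟨h₁, h₂⟩ := Prod.mk.inj h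
      have hxy : x = y := by
        rw [h₂, ← mul_assoc, mul_eq_right] at h₁
        rw [eq_inv_of_mul_eq_one_left h₁, inv_eq_of_mul_eq_one_left hy]
      subst hxy
      exact hx (mul_eq_right.1 h₁)
    rintro (x | x) hx (y | y) hy hxy <;>
      simp only [Finset.mem_coe, Finset.inl_mem_disjSum, Finset.inr_mem_disjSum, I,
        Finset.mem_filter, Finset.mem_erase] at hx hy
    · obtain ⟨h₁, h₂⟩ := Prod.mk.inj hxy
      rw [h₂] at h₁
      rw [mul_right_cancel h₁]
    · exact absurd hxy (mixed x y hx.1 hy.2.2)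
    · exact absurd hxy.symm (mixed y x hy.1 hx.2.2)
    · obtain ⟨h₁, h₂⟩ := Prod.mk.inj hxy
      rw [h₁] at h₂
      rw [mul_right_cancel h₂]
  have hle := Finset.card_le_card_of_injOn f hmaps hinj
  rw [Finset.card_disjSum, Finset.offDiag_card, Finset.card_erase_of_mem (Finset.mem_univ _),
    Finset.card_univ, ← Nat.card_eq_fintype_card, ← Set.ncard_eq_toFinset_card'] at hle
  have hI : Nat.card {x : G // x ≠ 1 ∧ x * x = 1} = I.card := by
    rw [Nat.card_eq_fintype_card, Fintype.card_subtype]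
  have hpos : 0 < Nat.card G := Nat.card_pos
  have hApos : 0 < A.ncard := (Set.ncard_pos).2 ⟨a 1, ha 1⟩
  have := Nat.le_mul_of_pos_left A.ncard hApos
  omega

theorem forall_selfLinked_iff :
    (∀ A : Set G, SelfLinked A → Nat.card G < 2 * A.ncard) ↔
      (Nat.card G ≤ 5 ∨ Nonempty (G ≃* DihedralGroup 3) ∨
        Nonempty (G ≃* Multiplicative (ZMod 2 × ZMod 2 × ZMod 2))) := by
  constructor
  · intro h
    by_contra! hne
    obtain ⟨h5, hD, hC⟩ := hne
    suffices ∃ A : Set G, SelfLinked A ∧ 2 * A.ncard ≤ Nat.card G by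
      obtain ⟨A, hA, hle⟩ := this
      exact (h A hA).not_ge hle
    by_cases hcyc : IsCyclic G
    · exact exists_selfLinked_of_isCyclic h5
    obtain ⟨k, hk | hk⟩ := Nat.even_or_odd' (Nat.card G)
    · rcases le_or_gt 6 k with h6 | h6
      · exact exists_selfLinked_of_even hk h6
      obtain rfl | rfl | rfl : k = 3 ∨ k = 4 ∨ k = 5 := by omega
      · obtain ⟨r, hr, hindex⟩ := exists_subgroup_index_two_of_prime (G := G) Nat.prime_three hk
        by_contra hno
        refine hD.false (nonempty_mulEquiv_dihedralGroup_three hk hr fun y hy => ?_).some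
        by_contra hyy
        exact hno (exists_selfLinked_of_index_two hindex (by rw [Nat.card_zpowers, hr]) hy hyy)
      · by_contra hno
        refine hC.false (nonempty_mulEquiv_of_card_eq_eight hk fun r => ?_).some
        by_contra hr
        exact hno (exists_selfLinked_of_card_eq_eight hk hcyc hr)
      · obtain ⟨r, hr, hindex⟩ := exists_subgroup_index_two_of_prime (G := G) Nat.prime_five hk
        exact exists_selfLinked_of_index_two_of_five_le hindex (by rw [Nat.card_zpowers, hr])
    · obtain ⟨A, hA⟩ := exists_ncard_eq (α := G) (k := k) (by omega)
      exact ⟨A, selfLinked_of_odd hcyc (by omega), by omega⟩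
  · intro h A hA
    have hle := hA.card_add_card_involutions_le
    have hpos : 0 < Nat.card G := Nat.card_pos
    have hApos : 0 < A.ncard := (Set.ncard_pos).2 ((hA 1).mono Set.inter_subset_left)
    by_contra! hcon
    rcases h with h | ⟨⟨e⟩⟩ | ⟨⟨e⟩⟩
    · have : A.ncard ≤ 2 := by omega
      interval_cases A.ncard <;> omega
    · have hG : Nat.card G = 6 := by rw [Nat.card_congr e.toEquiv, DihedralGroup.nat_card]
      have hI : Nat.card {x : DihedralGroup 3 // x ≠ 1 ∧ x * x = 1} = 3 := by
        rw [Nat.card_eq_fintype_card]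
        decide
      rw [card_involutions_congr e, hI] at hle
      have : A.ncard ≤ 3 := by omega
      interval_cases A.ncard <;> omega
    · have hG : Nat.card G = 8 := by
        rw [Nat.card_congr e.toEquiv]
        simp
      have hI : Nat.card {x : Multiplicative (ZMod 2 × ZMod 2 × ZMod 2) // x ≠ 1 ∧ x * x = 1} =
          7 := by
        rw [Nat.card_eq_fintype_card]
        decide
      rw [card_involutions_congr e, hI] at hle
      have : A.ncard ≤ 4 := by omega
      interval_cases A.ncard <;> omega

end

/-- For a finite group `G` the following are equivalent: (1) there is exactly one maximal
invariant linked system on `G`; (2) every self-linked subset `A ⊆ G` satisfies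
`2|A| > |G|`; (3) `|G| ≤ 5`, or `G` is isomorphic to the dihedral group `D₆` of order 6,
or to `C₂×C₂×C₂`. -/
theorem stmt13 {G : Type*} [Group G] [Finite G] :
    ((∃! L : Set (Set G), IsMaxInvLinked L) ↔
      (∀ A : Set G, (∀ x : G, (A ∩ x • A).Nonempty) → Nat.card G < 2 * A.ncard)) ∧
    ((∃! L : Set (Set G), IsMaxInvLinked L) ↔
      (Nat.card G ≤ 5 ∨ Nonempty (G ≃* DihedralGroup 3) ∨
        Nonempty (G ≃* Multiplicative (ZMod 2 × ZMod 2 × ZMod 2)))) := by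
  exact ⟨existsUnique_isMaxInvLinked_iff,
    existsUnique_isMaxInvLinked_iff.trans forall_selfLinked_iff⟩
end

section
/- Let X be a group and L a maximal linked system on X. The following are equivalent: (1) L is a left zero of λ(X), i.e. L∘A = L for every maximal linked system A on X; (2) L is a zero of λ(X), i.e. L∘A = L = A∘L for every maximal linked system A on X; (3) L is invariant and L is the unique invariant maximal linked system on X (every invariant maximal linked system on X equals L). -/
open Pointwise

theorem Linked.insert {X : Type*} {L : Set (Set X)} (hL : Linked L) {B : Set X}
    (hB : B.Nonempty) (h : ∀ A ∈ L, (A ∩ B).Nonempty) : Linked (insert B L) := by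
  rintro C (rfl | hC) D (rfl | hD)
  · simpa using hB
  · rw [Set.inter_comm]
    exact h D hD
  · exact h C hC
  · exact hL C hC D hD

theorem IsMaxLinked.mem_of_forall_inter_nonempty {X : Type*} {L : Set (Set X)}
    (hL : IsMaxLinked L) {B : Set X} (hB : B.Nonempty) (h : ∀ A ∈ L, (A ∩ B).Nonempty) :
    B ∈ L := by
  rw [← hL.2 _ (hL.1.insert hB h) (Set.subset_insert B L)]
  exact Set.mem_insert B L

theorem IsMaxLinked.mem_of_subset {X : Type*} {L : Set (Set X)} (hL : IsMaxLinked L)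
    {A B : Set X} (hA : A ∈ L) (hAB : A ⊆ B) : B ∈ L :=
  hL.mem_of_forall_inter_nonempty ((hL.1 A hA A hA).mono (Set.inter_subset_left.trans hAB))
    fun C hC => (hL.1 C hC A hA).mono (Set.inter_subset_inter_right C hAB)

theorem IsMaxLinked.univ_mem {X : Type*} [Nonempty X] {L : Set (Set X)} (hL : IsMaxLinked L) :
    Set.univ ∈ L :=
  hL.mem_of_forall_inter_nonempty Set.univ_nonempty fun A hA => by simpa using hL.1 A hA A hA

theorem Linked.empty_notMem {X : Type*} {L : Set (Set X)} (hL : Linked L) : ∅ ∉ L :=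
  fun h => by simpa using hL ∅ h ∅ h

theorem Linked.compl_notMem {X : Type*} {L : Set (Set X)} (hL : Linked L) {C : Set X}
    (hC : C ∈ L) : Cᶜ ∉ L :=
  fun h => by simpa using hL C hC Cᶜ h

theorem IsMaxLinked.mem_or_compl_mem {X : Type*} [Nonempty X] {L : Set (Set X)}
    (hL : IsMaxLinked L) (C : Set X) : C ∈ L ∨ Cᶜ ∈ L := by
  by_contra! h
  rcases C.eq_empty_or_nonempty with rfl | hC
  · exact h.2 (by simpa using hL.univ_mem)
  · refine h.1 (hL.mem_of_forall_inter_nonempty hC fun A hA => ?_)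
    by_contra hAC
    exact h.2 (hL.mem_of_subset hA
      (Set.disjoint_iff_inter_eq_empty.2 (Set.not_nonempty_iff_eq_empty.1 hAC)).subset_compl_right)

theorem Linked.isMaxLinked {X : Type*} {L : Set (Set X)} (hL : Linked L)
    (h : ∀ C, C ∈ L ∨ Cᶜ ∈ L) : IsMaxLinked L :=
  ⟨hL, fun _ hM hLM => Set.Subset.antisymm
    (fun C hC => (h C).resolve_right fun hC' => hM.compl_notMem hC (hLM hC')) hLM⟩

theorem IsMaxLinked.circ {X : Type*} [Group X] {A B : Set (Set X)} (hA : IsMaxLinked A)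
    (hB : IsMaxLinked B) : IsMaxLinked (circ A B) := by
  refine Linked.isMaxLinked (fun C hC D hD => ?_) fun C => ?_
  · obtain ⟨x, hxC, hxD⟩ := hA.1 _ hC _ hD
    obtain ⟨y, hyC, hyD⟩ := hB.1 _ hxC _ hxD
    exact ⟨x * y, hyC, hyD⟩
  · exact (hA.mem_or_compl_mem {x : X | (x * ·) ⁻¹' C ∈ B}).imp id fun h =>
      hA.mem_of_subset h fun x hx => (hB.mem_or_compl_mem _).resolve_left hx

theorem preimage_mul_left_eq_smul {X : Type*} [Group X] (x : X) (C : Set X) :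
    (x * ·) ⁻¹' C = x⁻¹ • C := by
  ext y
  simp [Set.mem_inv_smul_set_iff]

theorem Invariant.smul_mem_iff {X : Type*} [Group X] {L : Set (Set X)} (hL : Invariant L)
    (x : X) (C : Set X) : x • C ∈ L ↔ C ∈ L :=
  ⟨fun h => by simpa using hL x⁻¹ _ h, hL x C⟩

theorem circ_eq_right_of_invariant {X : Type*} [Group X] {A L : Set (Set X)}
    (hA : IsMaxLinked A) (hL : Invariant L) : circ A L = L := by
  ext C
  by_cases hC : C ∈ L
  · simpa [circ, preimage_mul_left_eq_smul, hL.smul_mem_iff, hC] using hA.univ_mem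
  · simpa [circ, preimage_mul_left_eq_smul, hL.smul_mem_iff, hC] using hA.1.empty_notMem

theorem Invariant.circ {X : Type*} [Group X] {L : Set (Set X)} (hL : Invariant L)
    (A : Set (Set X)) : Invariant (circ L A) := by
  intro y C hC
  change {x : X | (x * ·) ⁻¹' (y • C) ∈ A} ∈ L
  convert hL y _ hC using 1
  ext x
  simp [Set.mem_smul_set_iff_inv_smul_mem, preimage_mul_left_eq_smul, smul_smul]

theorem isMaxLinked_principal {X : Type*} (a : X) : IsMaxLinked {C : Set X | a ∈ C} :=
  Linked.isMaxLinked (fun _ hC _ hD => ⟨a, hC, hD⟩) fun C => Classical.em (a ∈ C)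

theorem IsMaxLinked.inv {X : Type*} [Group X] {L : Set (Set X)} (hL : IsMaxLinked L) :
    IsMaxLinked {C : Set X | C⁻¹ ∈ L} := by
  refine Linked.isMaxLinked (fun C hC D hD => ?_) fun C => ?_
  · simpa [← Set.inter_inv] using hL.1 _ hC _ hD
  · simpa [Set.compl_inv] using hL.mem_or_compl_mem C⁻¹

/-- Composing a left zero with principal systems shows that it is invariant under right
translations, so the system of inverses of its members is invariant under left translations. -/
theorem invariant_inv_of_left_zero {X : Type*} [Group X] {L : Set (Set X)}
    (h : ∀ A : Set (Set X), IsMaxLinked A → circ L A = L) :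
    Invariant {C : Set X | C⁻¹ ∈ L} := by
  intro x C hC
  change (x • C)⁻¹ ∈ L
  rw [← h _ (isMaxLinked_principal x⁻¹)]
  change {y : X | y * x⁻¹ ∈ (x • C)⁻¹} ∈ L
  convert (show C⁻¹ ∈ L from hC) using 1
  ext y
  simp [Set.mem_smul_set_iff_inv_smul_mem]

theorem invariant_and_unique_of_left_zero {X : Type*} [Group X] {L : Set (Set X)}
    (hL : IsMaxLinked L) (h : ∀ A : Set (Set X), IsMaxLinked A → circ L A = L) :
    Invariant L ∧ ∀ M : Set (Set X), IsMaxLinked M → Invariant M → M = L := by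
  have key : ∀ M : Set (Set X), IsMaxLinked M → Invariant M → M = L := fun M hM hinv =>
    (circ_eq_right_of_invariant hL hinv).symm.trans (h M hM)
  have hinv := invariant_inv_of_left_zero h
  exact ⟨key _ hL.inv hinv ▸ hinv, key⟩

/-- For a maximal linked system `L` on a group `X` the following are equivalent:
(1) `L` is a left zero of `λ(X)`; (2) `L` is a zero of `λ(X)`; (3) `L` is invariant and
is the unique invariant maximal linked system on `X`. -/
theorem stmt17 {X : Type*} [Group X] (L : Set (Set X)) (hL : IsMaxLinked L) :
    ((∀ A : Set (Set X), IsMaxLinked A → circ L A = L) ↔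
      (∀ A : Set (Set X), IsMaxLinked A → circ L A = L ∧ circ A L = L)) ∧
    ((∀ A : Set (Set X), IsMaxLinked A → circ L A = L) ↔
      (Invariant L ∧ ∀ M : Set (Set X), IsMaxLinked M → Invariant M → M = L)) := by
  refine ⟨⟨fun h A hA => ⟨h A hA, ?_⟩, fun h A hA => (h A hA).1⟩,
    invariant_and_unique_of_left_zero hL, fun h A hA => h.2 _ (hL.circ hA) (h.1.circ A)⟩
  exact circ_eq_right_of_invariant hA (invariant_and_unique_of_left_zero hL h).1
end
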